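/- For every integer m with m ≡ 1 (mod 4) (m = 1, 5, 9, ...): −|B_{m+1}|/(m+1) < γ_m < (3m+8)·|B_{m+3}|/24 − |B_{m+1}|/(m+1); and for every integer m with m ≡ 3 (mod 4) (m = 3, 7, 11, ...): |B_{m+1}|/(m+1) − (3m+8)·|B_{m+3}|/24 < γ_m < |B_{m+1}|/(m+1). -/

import Mathlib

open Finset Filter Real

/-- The defining sequence for the `m`-th generalized Euler (Stieltjes) constant:
`Σ_{k=1}^n ln^m k / k − ln^{m+1} n / (m+1)`. -/
noncomputable def stieltjesSeq (m : ℕ) (n : ℕ) : ℝ :=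
  (∑ k ∈ Finset.range n, (Real.log (k + 1)) ^ m / (k + 1)) -
    (Real.log n) ^ (m + 1) / (m + 1)

theorem exp_two_pi_mul_sub_one_pos {y : ℝ} (hy : 0 < y) : 0 < rexp (2 * π * y) - 1 := by
  have : 0 < 2 * π * y := by positivity
  linarith [Real.add_one_lt_exp this.ne']

theorem mul_exp_pi_le_exp_two_pi_sub_one {y : ℝ} (hy : 0 ≤ y) :
    y * rexp (π * y) ≤ rexp (2 * π * y) - 1 := by
  have hu : 0 ≤ π * y := by positivity
  have h := Real.self_le_sinh_iff.2 hu
  rw [Real.sinh_eq] at h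
  have h1 : rexp (2 * π * y) = rexp (π * y) * rexp (π * y) := by
    rw [← Real.exp_add]; ring_nf
  have h2 : rexp (π * y) * rexp (-(π * y)) = 1 := by rw [← Real.exp_add]; simp
  have h3 : y ≤ 2 * (π * y) := by nlinarith [Real.pi_gt_three]
  nlinarith [Real.exp_pos (π * y)]

theorem integral_pow_mul_exp_neg_mul {r : ℝ} (hr : 0 < r) (n : ℕ) :
    ∫ y in Set.Ioi (0 : ℝ), y ^ n * rexp (-(r * y)) = n.factorial / r ^ (n + 1) := by
  have h := Real.integral_rpow_mul_exp_neg_mul_Ioi (a := n + 1) (r := r) (by positivity) hr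
  rw [Real.Gamma_nat_eq_factorial] at h
  simp only [add_sub_cancel_right, Real.rpow_natCast] at h
  rw [h, ← Nat.cast_succ, Real.rpow_natCast, one_div, inv_pow, mul_comm]
  rfl

theorem integrableOn_pow_mul_exp_neg_mul {r : ℝ} (hr : 0 < r) (n : ℕ) :
    MeasureTheory.IntegrableOn (fun y : ℝ => y ^ n * rexp (-(r * y))) (Set.Ioi 0) := by
  refine not_imp_comm.1 MeasureTheory.integral_undef ?_
  rw [integral_pow_mul_exp_neg_mul hr]
  positivity

theorem integrableOn_pow_div_exp_sub_one {s : ℕ} (hs : s ≠ 0) :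
    MeasureTheory.IntegrableOn (fun y : ℝ => y ^ s / (rexp (2 * π * y) - 1)) (Set.Ioi 0) := by
  refine (integrableOn_pow_mul_exp_neg_mul Real.pi_pos (s - 1)).mono' ?_ ?_
  · exact (by fun_prop : Measurable fun y : ℝ =>
      y ^ s / (rexp (2 * π * y) - 1)).aestronglyMeasurable
  · refine (MeasureTheory.ae_restrict_iff' measurableSet_Ioi).2 (.of_forall fun y hy => ?_)
    have hy : 0 < y := hy
    have h0 := exp_two_pi_mul_sub_one_pos hy
    rw [Real.norm_of_nonneg (by positivity), div_le_iff₀ h0]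
    calc y ^ s = y ^ (s - 1) * rexp (-(π * y)) * (y * rexp (π * y)) := by
          rw [Real.exp_neg]
          obtain ⟨t, rfl⟩ := Nat.exists_eq_succ_of_ne_zero hs
          simp only [Nat.succ_eq_add_one, Nat.add_sub_cancel]
          field_simp
          ring
      _ ≤ _ := by gcongr; exact mul_exp_pi_le_exp_two_pi_sub_one hy.le

theorem hasSum_integral_pow_div_exp_sub_one {s : ℕ} (hs : s ≠ 0) :
    HasSum (fun k : ℕ => (s.factorial : ℝ) / (2 * π * (k + 1)) ^ (s + 1))
      (∫ y in Set.Ioi (0 : ℝ), y ^ s / (rexp (2 * π * y) - 1)) := by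
  set F : ℕ → ℝ → ℝ := fun k y => y ^ s * rexp (-(2 * π * (k + 1) * y)) with hF
  have hI (k : ℕ) : ∫ y in Set.Ioi (0 : ℝ), F k y = s.factorial / (2 * π * (k + 1)) ^ (s + 1) :=
    integral_pow_mul_exp_neg_mul (by positivity) s
  have hN (k : ℕ) : ∫ y in Set.Ioi (0 : ℝ), ‖F k y‖ =
      s.factorial / (2 * π * (k + 1)) ^ (s + 1) := by
    rw [← hI]
    refine MeasureTheory.setIntegral_congr_fun measurableSet_Ioi fun y hy => ?_
    have hy : 0 < y := hy
    exact Real.norm_of_nonneg (by positivity)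
  have hS : Summable fun k : ℕ => (s.factorial : ℝ) / (2 * π * (k + 1)) ^ (s + 1) := by
    have h1 := (summable_nat_add_iff 1).2
      (Real.summable_one_div_nat_pow.2 (by lia : 1 < s + 1))
    refine (h1.mul_left ((s.factorial : ℝ) / (2 * π) ^ (s + 1))).congr fun k => ?_
    push_cast
    rw [mul_pow _ ((k : ℝ) + 1), div_mul_div_comm, mul_one]
  have h := MeasureTheory.hasSum_integral_of_summable_integral_norm
    (μ := MeasureTheory.volume.restrict (Set.Ioi (0 : ℝ))) (F := F)
    (fun k => integrableOn_pow_mul_exp_neg_mul (by positivity) s) (by simpa only [hN] using hS)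
  simp only [hI] at h
  convert! h using 1
  refine MeasureTheory.setIntegral_congr_fun measurableSet_Ioi fun y hy => ?_
  have hy : 0 < y := hy
  have hlt : rexp (-(2 * π * y)) < 1 := by
    rw [Real.exp_lt_one_iff]; simpa using (by positivity : 0 < 2 * π * y)
  have hg := ((hasSum_geometric_of_lt_one (Real.exp_pos _).le hlt).mul_left
    (y ^ s * rexp (-(2 * π * y)))).tsum_eq
  have hterm (k : ℕ) : F k y = y ^ s * rexp (-(2 * π * y)) * rexp (-(2 * π * y)) ^ k := by
    rw [hF, ← Real.exp_nat_mul, mul_assoc, ← Real.exp_add]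
    ring_nf
  simp only [hterm]
  rw [hg, Real.exp_neg]
  have h0 := exp_two_pi_mul_sub_one_pos hy
  have h1 := Real.exp_pos (2 * π * y)
  have h2 : 1 - (rexp (2 * π * y))⁻¹ ≠ 0 := by
    rw [← Real.exp_neg]; linarith
  field_simp

theorem integral_pow_div_exp_sub_one {s : ℕ} (hs : s % 2 = 1) :
    ∫ y in Set.Ioi (0 : ℝ), y ^ s / (rexp (2 * π * y) - 1) =
      |((bernoulli (s + 1) : ℚ) : ℝ)| / (2 * (s + 1)) := by
  obtain ⟨k, hk, rfl⟩ : ∃ k : ℕ, k ≠ 0 ∧ s = 2 * k - 1 := ⟨(s + 1) / 2, by lia, by lia⟩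
  have h1 : 2 * k - 1 + 1 = 2 * k := by lia
  have hc : ((2 * k - 1 : ℕ) : ℝ) + 1 = 2 * k := by exact_mod_cast h1
  have hz := hasSum_zeta_nat hk
  have hpos := hz.nonneg fun n => by positivity
  have habs := abs_of_nonneg hpos
  rw [abs_div, abs_mul, abs_mul, abs_mul, abs_pow, abs_neg, abs_one, one_pow, one_mul,
    abs_of_pos (by positivity : (0 : ℝ) < 2 ^ (2 * k - 1)),
    abs_of_pos (by positivity : (0 : ℝ) < π ^ (2 * k)),
    abs_of_pos (by positivity : (0 : ℝ) < ((2 * k).factorial : ℝ))] at habs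
  rw [← habs] at hz
  have hz' := (hasSum_nat_add_iff' 1).2 hz
  simp only [Finset.sum_range_one, Nat.cast_zero, zero_pow (by lia : 2 * k ≠ 0), div_zero,
    sub_zero] at hz'
  have h2 := hasSum_integral_pow_div_exp_sub_one (s := 2 * k - 1) (by lia)
  refine h2.unique ?_
  rw [h1, hc]
  have hfac : ((2 * k).factorial : ℝ) = 2 * k * ((2 * k - 1).factorial : ℝ) := by
    rw [← Nat.mul_factorial_pred (by lia : 2 * k ≠ 0)]; push_cast; ring
  have hpw : (2 : ℝ) ^ (2 * k) = 2 * 2 ^ (2 * k - 1) := by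
    rw [← pow_succ', h1]
  convert! hz'.mul_left (((2 * k - 1).factorial : ℝ) / (2 * π) ^ (2 * k)) using 1
  · ext n
    push_cast
    rw [mul_pow _ ((n : ℝ) + 1), div_mul_div_comm, mul_one]
  · have hk' : (k : ℝ) ≠ 0 := by exact_mod_cast hk
    have hf : ((2 * k - 1).factorial : ℝ) ≠ 0 := by positivity
    rw [hfac, mul_pow, hpw]
    field_simp

theorem arctan_le_self_of_nonneg {x : ℝ} (hx : 0 ≤ x) : Real.arctan x ≤ x := by
  rcases lt_or_ge x (π / 2) with h | h
  · have := Real.le_tan hx h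
    calc Real.arctan x ≤ Real.arctan (Real.tan x) := Real.arctan_mono this
      _ = x := Real.arctan_tan (by linarith [Real.pi_pos]) h
  · exact (Real.arctan_lt_pi_div_two x).le.trans h

theorem div_le_arctan {x : ℝ} (hx : 0 ≤ x) : x / (1 + x ^ 2 / 3) ≤ Real.arctan x := by
  have hd (y : ℝ) : HasDerivAt (fun t => Real.arctan t - t / (1 + t ^ 2 / 3))
      (1 / (1 + y ^ 2) - (1 - y ^ 2 / 3) / (1 + y ^ 2 / 3) ^ 2) y := by
    have h1 : HasDerivAt (fun t : ℝ => 1 + t ^ 2 / 3) (2 * y / 3) y := by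
      simpa using ((hasDerivAt_pow 2 y).div_const 3).const_add 1
    convert! (Real.hasDerivAt_arctan y).sub ((hasDerivAt_id y).div h1 (by positivity)) using 1
    simp only [id]
    ring
  have hm : MonotoneOn (fun t => Real.arctan t - t / (1 + t ^ 2 / 3)) (Set.Ici 0) := by
    refine monotoneOn_of_deriv_nonneg (convex_Ici 0)
      (fun y _ => (hd y).continuousAt.continuousWithinAt)
      (fun y _ => (hd y).differentiableAt.differentiableWithinAt) fun y _ => ?_
    rw [(hd y).deriv, sub_nonneg, div_le_div_iff₀ (by positivity) (by positivity)]
    nlinarith [sq_nonneg (y ^ 2)]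
  have h := hm (Set.self_mem_Ici) (Set.mem_Ici.2 hx) hx
  simp only [Real.arctan_zero, zero_div, sub_zero] at h
  linarith

theorem div_one_add_sq_le_arctan {x : ℝ} (hx : 0 ≤ x) : x / (1 + x ^ 2) ≤ Real.arctan x :=
  (div_le_div_of_nonneg_left hx (by positivity) (by nlinarith)).trans (div_le_arctan hx)

theorem log_one_add_sq_le {x : ℝ} (hx : 0 ≤ x) :
    Real.log (1 + x ^ 2) ≤ x * Real.arctan x := by
  have hd (y : ℝ) : HasDerivAt (fun t => t * Real.arctan t - Real.log (1 + t ^ 2))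
      (Real.arctan y - y / (1 + y ^ 2)) y := by
    have h1 : HasDerivAt (fun t : ℝ => 1 + t ^ 2) (2 * y) y := by
      simpa using (hasDerivAt_pow 2 y).const_add 1
    convert! ((hasDerivAt_id y).mul (Real.hasDerivAt_arctan y)).sub (h1.log (by positivity)) using 1
    simp only [id]
    ring
  have hm : MonotoneOn (fun t => t * Real.arctan t - Real.log (1 + t ^ 2)) (Set.Ici 0) := by
    refine monotoneOn_of_deriv_nonneg (convex_Ici 0)
      (fun y _ => (hd y).continuousAt.continuousWithinAt)
      (fun y _ => (hd y).differentiableAt.differentiableWithinAt) fun y hy => ?_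
    rw [interior_Ici] at hy
    rw [(hd y).deriv, sub_nonneg]
    exact div_one_add_sq_le_arctan (le_of_lt hy)
  have h := hm (Set.self_mem_Ici) (Set.mem_Ici.2 hx) hx
  norm_num at h
  linarith

theorem sq_log_add_sq_arctan_le {x : ℝ} (hx : 0 ≤ x) :
    (Real.log (1 + x ^ 2) / 2) ^ 2 + Real.arctan x ^ 2 ≤ x ^ 2 := by
  have hd (y : ℝ) : HasDerivAt
      (fun t => t ^ 2 - ((Real.log (1 + t ^ 2) / 2) ^ 2 + Real.arctan t ^ 2))
      (2 * (y * (1 + y ^ 2) - y * (Real.log (1 + y ^ 2) / 2) - Real.arctan y) / (1 + y ^ 2)) y := by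
    have h1 : HasDerivAt (fun t : ℝ => 1 + t ^ 2) (2 * y) y := by
      simpa using (hasDerivAt_pow 2 y).const_add 1
    convert! (hasDerivAt_pow 2 y).sub
      ((((h1.log (by positivity)).div_const 2).pow 2).add ((Real.hasDerivAt_arctan y).pow 2)) using 1
    have : (1 + y ^ 2) ≠ 0 := by positivity
    field_simp
    push_cast
    ring
  have hm : MonotoneOn (fun t => t ^ 2 - ((Real.log (1 + t ^ 2) / 2) ^ 2 + Real.arctan t ^ 2))
      (Set.Ici 0) := by
    refine monotoneOn_of_deriv_nonneg (convex_Ici 0)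
      (fun y _ => (hd y).continuousAt.continuousWithinAt)
      (fun y _ => (hd y).differentiableAt.differentiableWithinAt) fun y hy => ?_
    rw [interior_Ici] at hy
    have hy : 0 < y := hy
    rw [(hd y).deriv]
    have h1 : Real.log (1 + y ^ 2) ≤ y ^ 2 := by
      linarith [Real.log_le_sub_one_of_pos (by positivity : 0 < 1 + y ^ 2)]
    have h2 : Real.arctan y ≤ y := arctan_le_self_of_nonneg hy.le
    have h3 : 0 ≤ y * (1 + y ^ 2) - y * (Real.log (1 + y ^ 2) / 2) - Real.arctan y := by
      nlinarith
    positivity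
  have h := hm (Set.self_mem_Ici) (Set.mem_Ici.2 hx) hx
  norm_num at h
  linarith

theorem Complex.log_one_add_mul_I (x : ℝ) :
    Complex.log (1 + x * Complex.I) =
      (Real.log (1 + x ^ 2) / 2 : ℝ) + (Real.arctan x : ℝ) * Complex.I := by
  have hn : ‖(1 + x * Complex.I : ℂ)‖ = √(1 + x ^ 2) := by
    rw [Complex.norm_eq_sqrt_sq_add_sq]; simp
  apply Complex.ext
  · rw [Complex.log_re, hn, Real.log_sqrt (by positivity)]
    simp [-Complex.ofReal_arctan]
  · rw [Complex.log_im, Complex.arg_of_re_nonneg (by simp), hn, Real.arctan_eq_arcsin]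
    simp [-Complex.ofReal_arctan]

theorem Complex.abs_arg_le_abs_im_div_re {w : ℂ} (hw : 0 < w.re) : |w.arg| ≤ |w.im| / w.re := by
  have h1 : |w.arg| < π / 2 := Complex.abs_arg_lt_pi_div_two_iff.2 (Or.inl hw)
  have h2 := Real.le_tan (abs_nonneg w.arg) h1
  have h3 : Real.tan |w.arg| = |Real.tan w.arg| := by
    rcases abs_cases w.arg with ⟨h, h'⟩ | ⟨h, h'⟩
    · rw [h, abs_of_nonneg (Real.tan_nonneg_of_nonneg_of_le_pi_div_two h' (h ▸ h1.le))]
    · rw [h, abs_of_nonpos (Real.tan_nonpos_of_nonpos_of_neg_pi_div_two_le h'.le (by linarith)),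
        Real.tan_neg]
  rw [h3, Complex.tan_arg, abs_div, abs_of_pos hw] at h2
  exact h2

theorem norm_log_one_add_mul_I_div_le {x : ℝ} (hx : 0 < x) :
    ‖Complex.log (1 + x * Complex.I) / (x * Complex.I)‖ ≤ 1 := by
  rw [norm_div, div_le_one (by simp [hx.ne']), Complex.log_one_add_mul_I x,
    Complex.norm_add_mul_I, norm_mul, Complex.norm_I, mul_one, Complex.norm_real]
  exact (Real.sqrt_le_left (norm_nonneg x)).2 (by simpa using sq_log_add_sq_arctan_le hx.le)

theorem le_norm_log_one_add_mul_I_div {x : ℝ} (hx : 0 < x) :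
    1 - 5 / 24 * x ^ 2 ≤ ‖Complex.log (1 + x * Complex.I) / (x * Complex.I)‖ := by
  rcases lt_or_ge 24 (5 * x ^ 2) with hneg | hneg
  · exact le_trans (by linarith) (norm_nonneg _)
  rw [norm_div, le_div_iff₀ (by simp [hx.ne']), Complex.log_one_add_mul_I x,
    Complex.norm_add_mul_I, norm_mul, Complex.norm_I, mul_one, Complex.norm_real,
    Real.norm_of_nonneg hx.le]
  apply Real.le_sqrt_of_sq_le
  have h1 := div_le_arctan hx.le
  have h2 := Real.le_log_one_add_of_nonneg (sq_nonneg x)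
  have h3 : (x / (1 + x ^ 2 / 3)) ^ 2 ≤ Real.arctan x ^ 2 := by gcongr
  have h4 : (x ^ 2 / (x ^ 2 + 2)) ^ 2 ≤ (Real.log (1 + x ^ 2) / 2) ^ 2 := by
    have h5 : x ^ 2 / (x ^ 2 + 2) ≤ Real.log (1 + x ^ 2) / 2 := by
      rw [mul_div_assoc] at h2
      linarith
    gcongr
  refine le_trans ?_ (add_le_add h4 h3)
  rw [div_pow, div_pow, div_add_div _ _ (by positivity) (by positivity),
    le_div_iff₀ (by positivity)]
  have hy : x ^ 2 * x ^ 2 ≤ 23.04 := by nlinarith [sq_nonneg x]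
  have h6 : 0 ≤ x ^ 6 * (828 + 2196 * x ^ 2 + x ^ 4 * (899 - 10 * x ^ 2 - 25 * (x ^ 2 * x ^ 2))) :=
    mul_nonneg (by positivity)
      (add_nonneg (by positivity) (mul_nonneg (by positivity) (by linarith)))
  nlinarith

theorem abs_arg_log_one_add_mul_I_div_le {x : ℝ} (hx : 0 < x) :
    |(Complex.log (1 + x * Complex.I) / (x * Complex.I)).arg| ≤ x / 2 := by
  have hat : 0 < Real.arctan x := Real.arctan_pos.2 hx
  have hw : Complex.log (1 + x * Complex.I) / (x * Complex.I) =
      (Real.arctan x / x : ℝ) + (-(Real.log (1 + x ^ 2) / 2 / x) : ℝ) * Complex.I := by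
    have hxc : (x : ℂ) ≠ 0 := by exact_mod_cast hx.ne'
    rw [Complex.log_one_add_mul_I x, div_eq_iff (by simp [hx.ne'])]
    simp only [Complex.ofReal_div, Complex.ofReal_neg, Complex.ofReal_ofNat]
    field_simp
    linear_combination (Real.log (1 + x ^ 2) : ℂ) * Complex.I_sq
  rw [hw]
  have hq : 0 < Real.arctan x / x := by positivity
  refine (Complex.abs_arg_le_abs_im_div_re (by simpa [-Complex.ofReal_arctan] using hq)).trans ?_
  have hl : 0 ≤ Real.log (1 + x ^ 2) := Real.log_nonneg (by nlinarith)
  simp only [Complex.add_im, Complex.add_re, Complex.ofReal_im, Complex.ofReal_re,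
    Complex.mul_im, Complex.mul_re, Complex.I_im, Complex.I_re, mul_one, mul_zero, add_zero,
    zero_add, sub_self, abs_neg]
  rw [abs_of_nonneg (by positivity), div_le_iff₀ (by positivity)]
  have := log_one_add_sq_le hx.le
  field_simp
  linarith

/-- The function `log (1 + ix) ^ m / (1 + ix)` divided by `(ix) ^ m`. -/
noncomputable def normalizedLogPow (m : ℕ) (x : ℝ) : ℂ :=
  (Complex.log (1 + x * Complex.I) / (x * Complex.I)) ^ m / (1 + x * Complex.I)

theorem norm_one_add_mul_I (x : ℝ) : ‖(1 + x * Complex.I : ℂ)‖ = √(1 + x ^ 2) := by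
  rw [Complex.norm_eq_sqrt_sq_add_sq]; simp

theorem normalizedLogPow_re_lt_one (m : ℕ) {x : ℝ} (hx : 0 < x) :
    (normalizedLogPow m x).re < 1 := by
  refine (Complex.re_le_norm _).trans_lt ?_
  have h1 : 1 < √(1 + x ^ 2) := Real.lt_sqrt_of_sq_lt (by nlinarith)
  rw [normalizedLogPow, norm_div, norm_pow, norm_one_add_mul_I, div_lt_one (by positivity)]
  exact (pow_le_one₀ (norm_nonneg _) (norm_log_one_add_mul_I_div_le hx)).trans_lt h1

theorem lt_normalizedLogPow_re (m : ℕ) {x : ℝ} (hx : 0 < x) :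
    1 - (m + 3) * (3 * m + 8) / 24 * x ^ 2 < (normalizedLogPow m x).re := by
  set P := Complex.log (1 + x * Complex.I) / (x * Complex.I) with hP
  set Q : ℂ := (1 + x * Complex.I)⁻¹ with hQ
  have hw : normalizedLogPow m x =
      ((‖P‖ ^ m * ‖Q‖ : ℝ) : ℂ) * Complex.exp ((m * P.arg + Q.arg : ℝ) * Complex.I) := by
    rw [normalizedLogPow, ← hP, div_eq_mul_inv, ← hQ]
    nth_rewrite 1 [← Complex.norm_mul_exp_arg_mul_I P]
    nth_rewrite 1 [← Complex.norm_mul_exp_arg_mul_I Q]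
    rw [mul_pow, ← Complex.exp_nat_mul]
    push_cast
    rw [add_mul, Complex.exp_add]
    ring_nf
  have hP1 := norm_log_one_add_mul_I_div_le hx
  have hP2 := le_norm_log_one_add_mul_I_div hx
  have hP3 := abs_arg_log_one_add_mul_I_div_le hx
  rw [← hP] at hP1 hP2 hP3
  have hPm1 : ‖P‖ ^ m ≤ 1 := pow_le_one₀ (norm_nonneg _) hP1
  have hPm2 : 1 - m * (5 / 24 * x ^ 2) ≤ ‖P‖ ^ m := by
    have h := one_add_mul_le_pow (a := ‖P‖ - 1) (by linarith [norm_nonneg P]) m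
    have h' : (m : ℝ) * (-(5 / 24 * x ^ 2)) ≤ m * (‖P‖ - 1) := by gcongr; linarith
    rw [add_sub_cancel] at h
    linarith
  have hsq : √(1 + x ^ 2) ^ 2 = 1 + x ^ 2 := Real.sq_sqrt (by positivity)
  have hs1 : 1 < √(1 + x ^ 2) := Real.lt_sqrt_of_sq_lt (by nlinarith)
  have hQn : ‖Q‖ = (√(1 + x ^ 2))⁻¹ := by rw [hQ, norm_inv, norm_one_add_mul_I]
  have hQ1 : ‖Q‖ ≤ 1 := by rw [hQn]; exact inv_le_one_of_one_le₀ hs1.le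
  have hQ2 : 1 - x ^ 2 / 2 < ‖Q‖ := by
    rw [hQn, ← one_div, lt_div_iff₀ (by positivity)]
    have hx2 : x ^ 2 = √(1 + x ^ 2) ^ 2 - 1 := by linarith
    nlinarith [mul_pos (pow_pos (sub_pos.2 hs1) 2)
      (by linarith : 0 < √(1 + x ^ 2) + 2)]
  have hQ3 : |Q.arg| ≤ x := by
    rw [hQ, Complex.abs_arg_inv]
    refine (Complex.abs_arg_le_abs_im_div_re (by simp)).trans ?_
    simp [abs_of_pos hx]
  set R := ‖P‖ ^ m * ‖Q‖ with hR
  set Θ := m * P.arg + Q.arg with hΘ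
  have hre : (normalizedLogPow m x).re = R * Real.cos Θ := by
    rw [hw, Complex.re_ofReal_mul, Complex.exp_ofReal_mul_I_re]
  have hR1 : R ≤ 1 := mul_le_one₀ hPm1 (norm_nonneg _) hQ1
  have hR2 : ‖P‖ ^ m + ‖Q‖ - 1 ≤ R := by nlinarith
  have hΘ1 : |Θ| ≤ (m / 2 + 1) * x := by
    calc |Θ| ≤ |m * P.arg| + |Q.arg| := abs_add_le _ _
      _ = m * |P.arg| + |Q.arg| := by rw [abs_mul, Nat.abs_cast]
      _ ≤ m * (x / 2) + x := by gcongr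
      _ = _ := by ring
  have hΘ2 : Θ ^ 2 ≤ ((m / 2 + 1) * x) ^ 2 := by
    rw [← sq_abs]; gcongr
  have hc1 := Real.cos_le_one Θ
  have hc2 := Real.one_sub_sq_div_two_le_cos (x := Θ)
  rw [hre]
  nlinarith [mul_nonneg (sub_nonneg.2 hR1) (sub_nonneg.2 hc1)]

theorem im_log_pow_div (m : ℕ) {x : ℝ} (hx : 0 < x) (hm : m % 4 = 1) :
    (Complex.log (1 + x * Complex.I) ^ m / (1 + x * Complex.I)).im =
      x ^ m * (normalizedLogPow m x).re := by
  have h : Complex.log (1 + x * Complex.I) ^ m / (1 + x * Complex.I) =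
      ((x ^ m : ℝ) : ℂ) * (Complex.I ^ m * normalizedLogPow m x) := by
    have hxc : (x : ℂ) ≠ 0 := by exact_mod_cast hx.ne'
    rw [normalizedLogPow, div_pow, mul_pow]
    push_cast
    field_simp
  rw [h, Complex.im_ofReal_mul, Complex.I_pow_eq_pow_mod, hm]
  simp

theorem im_log_pow_div' (m : ℕ) {x : ℝ} (hx : 0 < x) (hm : m % 4 = 3) :
    (Complex.log (1 + x * Complex.I) ^ m / (1 + x * Complex.I)).im =
      -(x ^ m * (normalizedLogPow m x).re) := by
  have h : Complex.log (1 + x * Complex.I) ^ m / (1 + x * Complex.I) =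
      ((x ^ m : ℝ) : ℂ) * (Complex.I ^ m * normalizedLogPow m x) := by
    have hxc : (x : ℂ) ≠ 0 := by exact_mod_cast hx.ne'
    rw [normalizedLogPow, div_pow, mul_pow]
    push_cast
    field_simp
  rw [h, Complex.im_ofReal_mul, Complex.I_pow_eq_pow_mod, hm]
  simp

theorem tendsto_div_of_hasDerivAt {f g : ℂ → ℂ} {p f' g' : ℂ} (hf : HasDerivAt f f' p)
    (hg : HasDerivAt g g' p) (hfp : f p = 0) (hgp : g p = 0) (hg' : g' ≠ 0) :
    Tendsto (fun z => f z / g z) (nhdsWithin p {p}ᶜ) (nhds (f' / g')) := by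
  refine ((hasDerivAt_iff_tendsto_slope.1 hf).div (hasDerivAt_iff_tendsto_slope.1 hg) hg').congr' ?_
  filter_upwards [self_mem_nhdsWithin] with z hz
  have hz : z - p ≠ 0 := sub_ne_zero.2 hz
  simp only [slope_def_field, hfp, hgp, sub_zero, Pi.div_apply]
  field_simp

theorem re_inv_sub_one_of_norm_eq_one {w : ℂ} (hw : ‖w‖ = 1) (hw1 : w ≠ 1) :
    ((w - 1)⁻¹).re = -1 / 2 := by
  have h1 : w.re * w.re + w.im * w.im = 1 := by
    rw [← Complex.normSq_apply, Complex.normSq_eq_norm_sq, hw, one_pow]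
  have h2 : w.re ≠ 1 := fun h => hw1 (Complex.ext (by simpa using h) (by
    rw [h] at h1
    have : w.im * w.im = 0 := by linarith
    simpa using this))
  have h3 : w.re - 1 ≠ 0 := sub_ne_zero.2 h2
  have h4 : Complex.normSq (w - 1) = -2 * (w.re - 1) := by
    rw [Complex.normSq_apply]; simp; linarith
  rw [Complex.inv_re, h4]
  simp only [Complex.sub_re, Complex.one_re]
  field_simp

/-- The function `e^{-2πiz} - 1`, whose zeros are the integers. -/
noncomputable def expSubOne (z : ℂ) : ℂ := Complex.exp (-(2 * π * Complex.I * z)) - 1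

theorem hasDerivAt_expSubOne (z : ℂ) : HasDerivAt expSubOne
    (Complex.exp (-(2 * π * Complex.I * z)) * -(2 * π * Complex.I)) z := by
  have h : HasDerivAt (fun z : ℂ => -(2 * π * Complex.I * z)) (-(2 * π * Complex.I)) z := by
    simpa using ((hasDerivAt_id z).const_mul (2 * π * Complex.I)).fun_neg
  exact h.cexp.sub_const 1

theorem expSubOne_natCast_add (n : ℕ) (y : ℝ) :
    expSubOne (n + y * Complex.I) = ((rexp (2 * π * y) - 1 : ℝ) : ℂ) := by
  have h : -(2 * π * Complex.I * (n + y * Complex.I)) =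
      ((2 * π * y : ℝ) : ℂ) - n * (2 * π * Complex.I) := by
    push_cast
    linear_combination (-2 * π * y : ℂ) * Complex.I_sq
  rw [expSubOne, h, Complex.exp_periodic.sub_nat_mul_eq n]
  push_cast
  rfl

theorem expSubOne_natCast (n : ℕ) : expSubOne n = 0 := by
  simpa using expSubOne_natCast_add n 0

theorem exists_int_of_expSubOne_eq_zero {z : ℂ} (h : expSubOne z = 0) : ∃ k : ℤ, z = k := by
  obtain ⟨k, hk⟩ := Complex.exp_eq_one_iff.1 (sub_eq_zero.1 h)
  refine ⟨-k, ?_⟩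
  have : (2 * π * Complex.I : ℂ) ≠ 0 := Complex.two_pi_I_ne_zero
  apply mul_left_cancel₀ this
  push_cast
  linear_combination -hk

theorem norm_exp_neg_two_pi_I_mul (x y : ℝ) :
    ‖Complex.exp (-(2 * π * Complex.I * (x + y * Complex.I)))‖ = rexp (2 * π * y) := by
  rw [Complex.norm_exp]
  simp

theorem exp_sub_one_le_norm_expSubOne (x y : ℝ) :
    rexp (2 * π * y) - 1 ≤ ‖expSubOne (x + y * Complex.I)‖ := by
  have h := norm_sub_norm_le (Complex.exp (-(2 * π * Complex.I * (x + y * Complex.I)))) 1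
  rwa [norm_exp_neg_two_pi_I_mul, norm_one] at h

theorem rect_identity {g : ℂ → ℂ} {n : ℕ} (hn : 1 ≤ n)
    (hg : ∀ z : ℂ, 0 < z.re → DifferentiableAt ℂ g z) (hreal : ∀ x : ℝ, 0 < x → (g x).im = 0)
    (h0 : g n = 0) (h1 : g (n + 1 : ℕ) = 0) {H : ℝ} (hH : 0 < H) :
    (∫ x in (n : ℝ)..(n + 1 : ℕ), (g x).re) * (-1 / 2) -
      (∫ x in (n : ℝ)..(n + 1 : ℕ), g (x + H * Complex.I) / expSubOne (x + H * Complex.I)).re -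
      (∫ y in (0 : ℝ)..H, (g ((n + 1 : ℕ) + y * Complex.I)).im / (rexp (2 * π * y) - 1)) +
      (∫ y in (0 : ℝ)..H, (g (n + y * Complex.I)).im / (rexp (2 * π * y) - 1)) = 0 := by
  have hn0 : (0 : ℝ) < n := by exact_mod_cast hn
  have hle : (n : ℝ) ≤ (n + 1 : ℕ) := by push_cast; linarith
  have hne : (n : ℂ) ≠ (n + 1 : ℕ) := by simp
  have hlim (k : ℕ) (hk : 0 < k) (hgk : g k = 0) := tendsto_div_of_hasDerivAt
    (hg k (by simpa using hk)).hasDerivAt (hasDerivAt_expSubOne k) hgk (expSubOne_natCast k)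
    (mul_ne_zero (Complex.exp_ne_zero _) (neg_ne_zero.2 Complex.two_pi_I_ne_zero))
  set q : ℂ → ℂ := fun z => g z / expSubOne z with hq
  obtain ⟨L0, hL0⟩ : ∃ L, Tendsto q (nhdsWithin (n : ℂ) {(n : ℂ)}ᶜ) (nhds L) :=
    ⟨_, hlim n hn h0⟩
  obtain ⟨L1, hL1⟩ : ∃ L, Tendsto q (nhdsWithin ((n + 1 : ℕ) : ℂ) {((n + 1 : ℕ) : ℂ)}ᶜ) (nhds L) :=
    ⟨_, hlim (n + 1) n.succ_pos h1⟩
  set G : ℂ → ℂ := Function.update (Function.update q n L0) (n + 1 : ℕ) L1 with hG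
  have hGq (z : ℂ) (hz0 : z ≠ n) (hz1 : z ≠ (n + 1 : ℕ)) : G z = q z := by
    rw [hG, Function.update_of_ne hz1, Function.update_of_ne hz0]
  have hE (z : ℂ) (hz : n ≤ z.re) (hz' : z.re ≤ (n + 1 : ℕ)) (hz0 : z ≠ n)
      (hz1 : z ≠ (n + 1 : ℕ)) : expSubOne z ≠ 0 := by
    intro h
    obtain ⟨k, rfl⟩ := exists_int_of_expSubOne_eq_zero h
    simp only [Complex.intCast_re] at hz hz'
    have hk : (n : ℤ) ≤ k := by exact_mod_cast hz
    have hk' : k ≤ (n + 1 : ℕ) := by exact_mod_cast hz'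
    have : k = n ∨ k = (n + 1 : ℕ) := by lia
    rcases this with rfl | rfl
    · exact hz0 (by simp)
    · exact hz1 (by simp)
  have hqd (z : ℂ) (hz : n ≤ z.re) (hz' : z.re ≤ (n + 1 : ℕ)) (hz0 : z ≠ n)
      (hz1 : z ≠ (n + 1 : ℕ)) : DifferentiableAt ℂ G z := by
    have hd : DifferentiableAt ℂ q z :=
      (hg z (hn0.trans_le hz)).div (hasDerivAt_expSubOne z).differentiableAt (hE z hz hz' hz0 hz1)
    refine hd.congr_of_eventuallyEq ?_
    filter_upwards [isOpen_ne.mem_nhds hz0, isOpen_ne.mem_nhds hz1] with w hw0 hw1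
    exact hGq w hw0 hw1
  have hGc (z : ℂ) (hz : n ≤ z.re) (hz' : z.re ≤ (n + 1 : ℕ)) : ContinuousAt G z := by
    by_cases hz1 : z = (n + 1 : ℕ)
    · subst hz1
      refine continuousAt_update_same.2 (hL1.congr' ?_)
      filter_upwards [nhdsWithin_le_nhds (isOpen_ne.mem_nhds hne.symm)] with w hw
      rw [Function.update_of_ne hw]
    by_cases hz0 : z = n
    · subst hz0
      rw [hG, continuousAt_update_of_ne hne]
      exact continuousAt_update_same.2 hL0
    exact (hqd z hz hz' hz0 hz1).continuousAt
  have hrect := Complex.integral_boundary_rect_eq_zero_of_continuousOn_of_differentiableOn G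
    ⟨n, 0⟩ ⟨(n + 1 : ℕ), H⟩ ?_ ?_
  rotate_left
  · intro z hz
    rw [Complex.mem_reProdIm, Set.uIcc_of_le hle] at hz
    exact (hGc z hz.1.1 hz.1.2).continuousWithinAt
  · intro z hz
    simp only [Complex.mem_reProdIm, min_eq_left hle, max_eq_right hle] at hz
    refine (hqd z hz.1.1.le hz.1.2.le ?_ ?_).differentiableWithinAt <;> rintro rfl
    · simpa using hz.1.1
    · simpa using hz.1.2
  dsimp only at hrect
  have hbot : (∫ x in (n : ℝ)..(n + 1 : ℕ), G (x + (0 : ℝ) * Complex.I)).re =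
      (∫ x in (n : ℝ)..(n + 1 : ℕ), (g x).re) * (-1 / 2) := by
    rw [← Complex.reCLM_apply, ← ContinuousLinearMap.intervalIntegral_comp_comm,
      ← intervalIntegral.integral_mul_const]
    · refine intervalIntegral.integral_congr_uIoo fun x hx => ?_
      rw [Set.uIoo_of_le hle] at hx
      have hx0 : (x : ℂ) ≠ n := by exact_mod_cast hx.1.ne'
      have hx1 : (x : ℂ) ≠ (n + 1 : ℕ) := by exact_mod_cast hx.2.ne
      have hgx : g x = ((g x).re : ℂ) := Complex.ext rfl (hreal x (hn0.trans hx.1))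
      have hne := hE x hx.1.le hx.2.le hx0 hx1
      have hnorm := norm_exp_neg_two_pi_I_mul x 0
      simp only [Complex.ofReal_zero, zero_mul, add_zero, mul_zero, Real.exp_zero] at hnorm
      simp only [Complex.ofReal_zero, zero_mul, add_zero, Complex.reCLM_apply]
      rw [hGq _ hx0 hx1, hq]
      dsimp only
      nth_rewrite 1 [hgx]
      rw [div_eq_mul_inv, Complex.re_ofReal_mul, expSubOne,
        re_inv_sub_one_of_norm_eq_one hnorm (sub_ne_zero.1 hne)]
    · refine ContinuousOn.intervalIntegrable fun x hx => ContinuousAt.continuousWithinAt ?_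
      rw [Set.uIcc_of_le hle] at hx
      exact ContinuousAt.comp (hGc _ (by simpa using hx.1) (by simpa using hx.2)) (by fun_prop)
  have htop : (∫ x in (n : ℝ)..(n + 1 : ℕ), G (x + H * Complex.I)) =
      ∫ x in (n : ℝ)..(n + 1 : ℕ), g (x + H * Complex.I) / expSubOne (x + H * Complex.I) := by
    refine intervalIntegral.integral_congr fun x _ => hGq _ (fun h => ?_) (fun h => ?_) <;>
    · have := congrArg Complex.im h
      simp [hH.ne'] at this
  have hvert (k : ℕ) (hk : n ≤ k) (hk' : k ≤ n + 1) :
      (Complex.I • ∫ y in (0 : ℝ)..H, G ((k : ℝ) + y * Complex.I)).re =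
        -∫ y in (0 : ℝ)..H, (g (k + y * Complex.I)).im / (rexp (2 * π * y) - 1) := by
    rw [smul_eq_mul, Complex.I_mul_re, neg_inj, ← Complex.imCLM_apply,
      ← ContinuousLinearMap.intervalIntegral_comp_comm]
    · refine intervalIntegral.integral_congr_uIoo fun y hy => ?_
      rw [Set.uIoo_of_le hH.le] at hy
      have hy0 : y ≠ 0 := hy.1.ne'
      have hGk : G ((k : ℝ) + y * Complex.I) = q ((k : ℝ) + y * Complex.I) := by
        refine hGq _ (fun h => ?_) (fun h => ?_) <;>
        · have := congrArg Complex.im h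
          simp [hy0] at this
      simp only [Complex.imCLM_apply]
      rw [hGk, hq]
      dsimp only
      rw [Complex.ofReal_natCast, expSubOne_natCast_add, Complex.div_ofReal_im]
    · refine ContinuousOn.intervalIntegrable fun y hy => ContinuousAt.continuousWithinAt ?_
      refine ContinuousAt.comp (hGc _ ?_ ?_) (by fun_prop)
      · simpa using hk
      · simpa using (by exact_mod_cast hk' : (k : ℝ) ≤ n + 1)
  have hre := congrArg Complex.re hrect
  rw [Complex.sub_re, Complex.add_re, Complex.sub_re, hbot, htop,
    hvert n le_rfl n.le_succ, hvert (n + 1) n.le_succ le_rfl, Complex.zero_re] at hre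
  linarith

theorem tendsto_affine_div_exp_sub_one (A B : ℝ) :
    Tendsto (fun H : ℝ => (A + B * H) / (rexp (2 * π * H) - 1)) atTop (nhds 0) := by
  have h1 : Tendsto (fun H : ℝ => rexp (-(π * H))) atTop (nhds 0) :=
    Real.tendsto_exp_neg_atTop_nhds_zero.comp (tendsto_id.const_mul_atTop Real.pi_pos)
  refine squeeze_zero_norm' (a := fun H => (|A| + |B|) * rexp (-(π * H))) ?_
    (by simpa using h1.const_mul (|A| + |B|))
  filter_upwards [eventually_ge_atTop 1] with H hH
  have hH0 : 0 < H := by linarith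
  have h2 := mul_exp_pi_le_exp_two_pi_sub_one hH0.le
  have h3 := exp_two_pi_mul_sub_one_pos hH0
  rw [norm_div, Real.norm_eq_abs, Real.norm_of_nonneg h3.le, div_le_iff₀ h3]
  calc |A + B * H| ≤ |A| + |B| * H := by
        refine (abs_add_le _ _).trans ?_
        rw [abs_mul, abs_of_pos hH0]
    _ ≤ (|A| + |B|) * H := by nlinarith [abs_nonneg A]
    _ = (|A| + |B|) * rexp (-(π * H)) * (H * rexp (π * H)) := by
        rw [Real.exp_neg]; field_simp
    _ ≤ _ := by gcongr

theorem abs_im_le_mul_of_norm_deriv_le {f : ℂ → ℂ} {a C y : ℝ}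
    (hf : ∀ z : ℂ, a ≤ z.re → DifferentiableAt ℂ f z) (hreal : (f a).im = 0)
    (hder : ∀ z : ℂ, a ≤ z.re → ‖deriv f z‖ ≤ C) (hy : 0 ≤ y) :
    |(f (a + y * Complex.I)).im| ≤ C * y := by
  have hconv : Convex ℝ {z : ℂ | a ≤ z.re} := convex_halfSpace_re_ge a
  have hmem : (a : ℂ) ∈ {z : ℂ | a ≤ z.re} := by simp
  have hmem' : (a + y * Complex.I : ℂ) ∈ {z : ℂ | a ≤ z.re} := by simp
  have h := hconv.norm_image_sub_le_of_norm_deriv_le (f := f) (x := (a : ℂ))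
    (y := a + y * Complex.I) (C := C) (fun z hz => hf z hz) (fun z hz => hder z hz)
    hmem hmem'
  have h2 := (Complex.abs_im_le_norm _).trans h
  rw [Complex.sub_im, hreal, sub_zero, add_sub_cancel_left, norm_mul, Complex.norm_I, mul_one,
    Complex.norm_real, Real.norm_of_nonneg hy] at h2
  exact h2

theorem integrableOn_im_div_exp_sub_one {f : ℂ → ℂ} {a C : ℝ}
    (hf : ∀ z : ℂ, a ≤ z.re → DifferentiableAt ℂ f z) (hreal : (f a).im = 0)
    (hder : ∀ z : ℂ, a ≤ z.re → ‖deriv f z‖ ≤ C) :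
    MeasureTheory.IntegrableOn
      (fun y : ℝ => (f (a + y * Complex.I)).im / (rexp (2 * π * y) - 1)) (Set.Ioi 0) := by
  refine ((integrableOn_pow_div_exp_sub_one one_ne_zero).const_mul C).mono' ?_ ?_
  · refine ContinuousOn.aestronglyMeasurable (fun y hy => ContinuousAt.continuousWithinAt ?_)
      measurableSet_Ioi
    have h1 : ContinuousAt (fun y : ℝ => f (a + y * Complex.I)) y :=
      ContinuousAt.comp (hf _ (by simp)).continuousAt (by fun_prop)
    exact (Complex.continuous_im.continuousAt.comp h1).div (by fun_prop)
      (exp_two_pi_mul_sub_one_pos hy).ne'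
  · refine (MeasureTheory.ae_restrict_iff' measurableSet_Ioi).2 (.of_forall fun y hy => ?_)
    have h0 := exp_two_pi_mul_sub_one_pos hy
    rw [norm_div, Real.norm_of_nonneg h0.le, pow_one, ← mul_div_assoc]
    gcongr
    exact abs_im_le_mul_of_norm_deriv_le hf hreal hder (le_of_lt hy)

/-- The Abel–Plana integral on the vertical line through `a`. -/
noncomputable def abelPlanaIntegral (f : ℂ → ℂ) (a : ℝ) : ℝ :=
  ∫ y in Set.Ioi (0 : ℝ), (f (a + y * Complex.I)).im / (rexp (2 * π * y) - 1)

theorem abs_abelPlanaIntegral_le {f : ℂ → ℂ} {a C : ℝ}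
    (hf : ∀ z : ℂ, a ≤ z.re → DifferentiableAt ℂ f z) (hreal : (f a).im = 0)
    (hder : ∀ z : ℂ, a ≤ z.re → ‖deriv f z‖ ≤ C) :
    |abelPlanaIntegral f a| ≤ C * ∫ y in Set.Ioi (0 : ℝ), y ^ 1 / (rexp (2 * π * y) - 1) := by
  rw [← MeasureTheory.integral_const_mul, abelPlanaIntegral, ← Real.norm_eq_abs]
  refine MeasureTheory.norm_integral_le_of_norm_le
    ((integrableOn_pow_div_exp_sub_one one_ne_zero).const_mul C) ?_
  refine (MeasureTheory.ae_restrict_iff' measurableSet_Ioi).2 (.of_forall fun y hy => ?_)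
  have h0 := exp_two_pi_mul_sub_one_pos hy
  rw [norm_div, Real.norm_of_nonneg h0.le, pow_one, ← mul_div_assoc]
  gcongr
  exact abs_im_le_mul_of_norm_deriv_le hf hreal hder (le_of_lt hy)

/-- The error of the trapezoidal rule on a unit interval as a difference of Abel–Plana
integrals. -/
theorem trapezoid_error_eq {f : ℂ → ℂ} {n : ℕ} (hn : 1 ≤ n) {C : ℝ}
    (hf : ∀ z : ℂ, 0 < z.re → DifferentiableAt ℂ f z) (hreal : ∀ x : ℝ, 0 < x → (f x).im = 0)
    (hbd : ∀ z : ℂ, 1 ≤ z.re → ‖f z‖ ≤ C) (hder : ∀ z : ℂ, 1 ≤ z.re → ‖deriv f z‖ ≤ C) :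
    ((f n).re + (f (n + 1 : ℕ)).re) / 2 - ∫ x in (n : ℝ)..(n + 1 : ℕ), (f x).re =
      -2 * abelPlanaIntegral f n + 2 * abelPlanaIntegral f (n + 1 : ℕ) := by
  have hn1 : (1 : ℝ) ≤ n := by exact_mod_cast hn
  have hn0 : (0 : ℝ) < n := by linarith
  have hle : (n : ℝ) ≤ (n + 1 : ℕ) := by push_cast; linarith
  have hfn : f n = ((f n).re : ℂ) :=
    Complex.ext rfl (by simpa using hreal n hn0)
  have hfn1 : f (n + 1 : ℕ) = ((f (n + 1 : ℕ)).re : ℂ) :=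
    Complex.ext rfl (by simpa using hreal (n + 1 : ℕ) (hn0.trans_le hle))
  set α := (f n).re with hα
  set β := (f (n + 1 : ℕ)).re with hβ
  set g : ℂ → ℂ := fun z => f z - (α + (z - n) * (β - α : ℝ)) with hg
  have hgd (z : ℂ) (hz : 0 < z.re) : DifferentiableAt ℂ g z :=
    (hf z hz).sub (by fun_prop)
  have hgreal (x : ℝ) (hx : 0 < x) : (g x).im = 0 := by
    simp [hg, hreal x hx]
  have hg0 : g n = 0 := by simp [hg, hfn]
  have hg1 : g (n + 1 : ℕ) = 0 := by
    simp only [hg]; rw [hfn1]; push_cast; ring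
  set k : ℝ → ℝ := fun y => rexp (2 * π * y) - 1 with hk
  have hK := integrableOn_pow_div_exp_sub_one one_ne_zero
  have hgim (c : ℕ) (y : ℝ) : (g (c + y * Complex.I)).im / (rexp (2 * π * y) - 1) =
      (f ((c : ℝ) + y * Complex.I)).im / (rexp (2 * π * y) - 1) -
        (β - α) * (y ^ 1 / (rexp (2 * π * y) - 1)) := by
    simp only [hg]
    rw [Complex.sub_im, sub_div]
    simp
    ring
  have hfint (c : ℕ) (hc : 1 ≤ c) := integrableOn_im_div_exp_sub_one (f := f) (a := c) (C := C)
    (fun z hz => hf z (lt_of_lt_of_le (by exact_mod_cast hc) hz))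
    (hreal c (by exact_mod_cast hc)) (fun z hz => hder z (le_trans (by exact_mod_cast hc) hz))
  have hlim (c : ℕ) (hc : 1 ≤ c) : Tendsto
      (fun H : ℝ => ∫ y in (0 : ℝ)..H, (g (c + y * Complex.I)).im / (rexp (2 * π * y) - 1)) atTop
      (nhds (abelPlanaIntegral f c - (β - α) *
        ∫ y in Set.Ioi (0 : ℝ), y ^ 1 / (rexp (2 * π * y) - 1))) := by
    simp only [hgim]
    rw [abelPlanaIntegral, ← MeasureTheory.integral_const_mul,
      ← MeasureTheory.integral_sub (hfint c hc) (hK.const_mul _)]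
    exact MeasureTheory.intervalIntegral_tendsto_integral_Ioi 0
      ((hfint c hc).sub (hK.const_mul _)) tendsto_id
  have htop : Tendsto (fun H : ℝ => (∫ x in (n : ℝ)..(n + 1 : ℕ),
      g (x + H * Complex.I) / expSubOne (x + H * Complex.I)).re) atTop (nhds 0) := by
    refine squeeze_zero_norm' ?_
      (tendsto_affine_div_exp_sub_one (C + |α| + |β - α|) |β - α|)
    filter_upwards [eventually_gt_atTop 0] with H hH
    have h0 := exp_two_pi_mul_sub_one_pos hH
    refine (Complex.abs_re_le_norm _).trans
      ((intervalIntegral.norm_integral_le_of_norm_le_const (C :=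
        (C + |α| + |β - α| + |β - α| * H) / (rexp (2 * π * H) - 1)) ?_).trans (by simp))
    intro x hx
    rw [Set.uIoc_of_le hle] at hx
    have hx2 : x ≤ n + 1 := by simpa using hx.2
    rw [norm_div]
    refine div_le_div₀ ?_ ?_ h0 (exp_sub_one_le_norm_expSubOne x H)
    · have := (norm_nonneg _).trans (hbd 1 (by simp))
      positivity
    · have h1 : ‖f (x + H * Complex.I)‖ ≤ C := hbd _ (by simpa using hn1.trans hx.1.le)
      have h2 : ‖(x + H * Complex.I - n : ℂ)‖ ≤ 1 + H := by
        have : (x + H * Complex.I - n : ℂ) = ((x - n : ℝ) : ℂ) + H * Complex.I := by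
          push_cast; ring
        rw [this]
        refine (norm_add_le _ _).trans (add_le_add ?_ ?_)
        · rw [Complex.norm_real, Real.norm_of_nonneg (by linarith [hx.1])]
          linarith
        · simp [abs_of_pos hH]
      calc ‖g (x + H * Complex.I)‖ ≤ ‖f (x + H * Complex.I)‖ +
            (‖(α : ℂ)‖ + ‖(x + H * Complex.I - n : ℂ)‖ * ‖((β - α : ℝ) : ℂ)‖) := by
            refine (norm_sub_le _ _).trans (add_le_add_right ((norm_add_le _ _).trans ?_) _)
            rw [norm_mul]
        _ ≤ C + (|α| + (1 + H) * |β - α|) := by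
            rw [Complex.norm_real, Complex.norm_real, Real.norm_eq_abs, Real.norm_eq_abs]
            gcongr
        _ = _ := by ring
  have hA := ((tendsto_const_nhds (x := (∫ x in (n : ℝ)..(n + 1 : ℕ), (g x).re) * (-1 / 2))
    (f := (atTop : Filter ℝ))).sub htop).sub (hlim (n + 1) (by lia)) |>.add (hlim n hn)
  have hz := tendsto_nhds_unique (hA.congr' (f₂ := fun _ => (0 : ℝ)) (by
    filter_upwards [eventually_gt_atTop 0] with H hH
    exact rect_identity hn hgd hgreal hg0 hg1 hH)) tendsto_const_nhds
  have hgint : ∫ x in (n : ℝ)..(n + 1 : ℕ), (g x).re =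
      (∫ x in (n : ℝ)..(n + 1 : ℕ), (f x).re) - (α + β) / 2 := by
    have hlin : ∫ x in (n : ℝ)..(n + 1 : ℕ), (α + (x - n) * (β - α)) = (α + β) / 2 := by
      rw [intervalIntegral.integral_add (by simp) (by apply Continuous.intervalIntegrable; fun_prop),
        intervalIntegral.integral_mul_const, intervalIntegral.integral_sub (by simp) (by simp)]
      simp
      ring
    rw [← hlin, ← intervalIntegral.integral_sub]
    · refine intervalIntegral.integral_congr fun x _ => ?_
      simp [hg]
    · refine ContinuousOn.intervalIntegrable fun x hx => ContinuousAt.continuousWithinAt ?_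
      rw [Set.uIcc_of_le hle] at hx
      exact Complex.continuous_re.continuousAt.comp (ContinuousAt.comp
        (f := fun x : ℝ => (x : ℂ)) (hf _ (by simpa using hn0.trans_le hx.1)).continuousAt
        (by fun_prop))
    · apply Continuous.intervalIntegrable; fun_prop
  rw [hgint] at hz
  linarith

/-- The function `log z ^ m / z`. -/
noncomputable def logPowDiv (m : ℕ) (z : ℂ) : ℂ := Complex.log z ^ m / z

theorem logPowDiv_ofReal (m : ℕ) {x : ℝ} (hx : 0 < x) :
    logPowDiv m x = (Real.log x ^ m / x : ℝ) := by
  rw [logPowDiv, ← Complex.ofReal_log hx.le]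
  push_cast
  rfl

theorem hasDerivAt_logPowDiv (m : ℕ) {z : ℂ} (hz : 0 < z.re) :
    HasDerivAt (logPowDiv m)
      ((m * Complex.log z ^ (m - 1) - Complex.log z ^ m) / z ^ 2) z := by
  have hz0 : z ≠ 0 := by rintro rfl; simp at hz
  have h := ((Complex.hasDerivAt_log (Or.inl hz)).fun_pow m).fun_div (hasDerivAt_id z) hz0
  convert! h using 1
  simp only [id]
  field_simp

theorem norm_log_pow_le (k : ℕ) {z : ℂ} (hz : 1 ≤ z.re) :
    ‖Complex.log z‖ ^ k ≤ k.factorial * rexp π * ‖z‖ := by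
  have hn : 1 ≤ ‖z‖ := hz.trans (Complex.re_le_norm z)
  have h1 : ‖Complex.log z‖ ≤ Real.log ‖z‖ + π := by
    refine (Complex.norm_le_abs_re_add_abs_im _).trans ?_
    rw [Complex.log_re, Complex.log_im, abs_of_nonneg (Real.log_nonneg hn)]
    gcongr
    exact Complex.abs_arg_le_pi z
  have h2 := Real.pow_div_factorial_le_exp (x := ‖Complex.log z‖) (norm_nonneg _) k
  rw [div_le_iff₀ (by positivity)] at h2
  have h3 : rexp ‖Complex.log z‖ ≤ rexp π * ‖z‖ := by
    refine (Real.exp_le_exp.2 h1).trans_eq ?_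
    rw [Real.exp_add, Real.exp_log (by linarith), mul_comm]
  calc _ ≤ _ := h2
    _ ≤ rexp π * ‖z‖ * k.factorial := by gcongr
    _ = _ := by ring

theorem norm_logPowDiv_le (m : ℕ) {z : ℂ} (hz : 1 ≤ z.re) :
    ‖logPowDiv m z‖ ≤ m.factorial * rexp π := by
  have hn : 1 ≤ ‖z‖ := hz.trans (Complex.re_le_norm z)
  rw [logPowDiv, norm_div, norm_pow, div_le_iff₀ (by linarith)]
  exact norm_log_pow_le m hz

theorem norm_deriv_logPowDiv_le {m : ℕ} (hm : m ≠ 0) {a : ℝ} (ha : 1 ≤ a) {z : ℂ}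
    (hz : a ≤ z.re) : ‖deriv (logPowDiv m) z‖ ≤ 2 * (m.factorial * rexp π) / a := by
  have hz1 := ha.trans hz
  have hn : a ≤ ‖z‖ := hz.trans (Complex.re_le_norm z)
  have hn0 : 0 < ‖z‖ := by linarith
  rw [(hasDerivAt_logPowDiv m (by linarith)).deriv, norm_div, norm_pow]
  have h1 : ‖(m * Complex.log z ^ (m - 1) - Complex.log z ^ m : ℂ)‖ ≤
      2 * (m.factorial * rexp π) * ‖z‖ := by
    refine (norm_sub_le _ _).trans ?_
    rw [norm_mul, norm_pow, norm_pow, Complex.norm_natCast]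
    have h2 := norm_log_pow_le m hz1
    have h3 : (m : ℝ) * ‖Complex.log z‖ ^ (m - 1) ≤ m.factorial * rexp π * ‖z‖ := by
      calc _ ≤ (m : ℝ) * ((m - 1).factorial * rexp π * ‖z‖) := by
            gcongr; exact norm_log_pow_le (m - 1) hz1
        _ = _ := by rw [← Nat.mul_factorial_pred hm]; push_cast; ring
    linarith
  calc _ ≤ 2 * (m.factorial * rexp π) * ‖z‖ / ‖z‖ ^ 2 := by gcongr
    _ = 2 * (m.factorial * rexp π) / ‖z‖ := by field_simp
    _ ≤ _ := by gcongr

theorem integral_log_pow_div (m : ℕ) {a b : ℝ} (ha : 0 < a) (hab : a ≤ b) :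
    ∫ x in a..b, Real.log x ^ m / x =
      Real.log b ^ (m + 1) / (m + 1) - Real.log a ^ (m + 1) / (m + 1) := by
  refine intervalIntegral.integral_eq_sub_of_hasDerivAt
    (f := fun x => Real.log x ^ (m + 1) / (m + 1)) (fun x hx => ?_) ?_
  · rw [Set.uIcc_of_le hab] at hx
    have hx0 : x ≠ 0 := (ha.trans_le hx.1).ne'
    have hm : (m : ℝ) + 1 ≠ 0 := by positivity
    convert! ((Real.hasDerivAt_log hx0).fun_pow (m + 1)).div_const ((m : ℝ) + 1) using 1
    push_cast
    field_simp
  · refine ContinuousOn.intervalIntegrable fun x hx => ContinuousAt.continuousWithinAt ?_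
    rw [Set.uIcc_of_le hab] at hx
    have hx0 : x ≠ 0 := (ha.trans_le hx.1).ne'
    fun_prop (disch := assumption)

theorem stieltjesSeq_succ_eq {m : ℕ} (hm : m ≠ 0) (n : ℕ) :
    stieltjesSeq m (n + 1) = (Real.log (n + 1 : ℕ) ^ m / (n + 1 : ℕ)) / 2 -
      2 * abelPlanaIntegral (logPowDiv m) (1 : ℕ) +
      2 * abelPlanaIntegral (logPowDiv m) (n + 1 : ℕ) := by
  induction n with
  | zero => simp [stieltjesSeq, hm]
  | succ n ih =>
    have hpos : (0 : ℝ) < (n + 1 : ℕ) := by positivity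
    have hC : (m.factorial * rexp π : ℝ) ≤ 2 * (m.factorial * rexp π) := by
      linarith [(by positivity : 0 < m.factorial * rexp π)]
    have h := trapezoid_error_eq (f := logPowDiv m) (n := n + 1) n.succ_pos
      (C := 2 * (m.factorial * rexp π))
      (fun z hz => (hasDerivAt_logPowDiv m hz).differentiableAt)
      (fun x hx => by rw [logPowDiv_ofReal m hx, Complex.ofReal_im])
      (fun z hz => (norm_logPowDiv_le m hz).trans hC)
      (fun z hz => by simpa using norm_deriv_logPowDiv_le hm le_rfl hz)
    have hint : ∫ x in ((n + 1 : ℕ) : ℝ)..(n + 1 + 1 : ℕ), (logPowDiv m x).re =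
        Real.log (n + 1 + 1 : ℕ) ^ (m + 1) / (m + 1) -
          Real.log (n + 1 : ℕ) ^ (m + 1) / (m + 1) := by
      have hle : ((n + 1 : ℕ) : ℝ) ≤ (n + 1 + 1 : ℕ) := by push_cast; linarith
      rw [← integral_log_pow_div m hpos hle]
      refine intervalIntegral.integral_congr fun x hx => ?_
      rw [Set.uIcc_of_le hle] at hx
      rw [logPowDiv_ofReal m (hpos.trans_le hx.1), Complex.ofReal_re]
    rw [hint, ← Complex.ofReal_natCast, ← Complex.ofReal_natCast (n + 1 + 1),
      logPowDiv_ofReal m hpos, logPowDiv_ofReal m (by positivity), Complex.ofReal_re,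
      Complex.ofReal_re] at h
    have hstep : stieltjesSeq m (n + 1 + 1) = stieltjesSeq m (n + 1) +
        Real.log (n + 1 + 1 : ℕ) ^ m / (n + 1 + 1 : ℕ) -
        (Real.log (n + 1 + 1 : ℕ) ^ (m + 1) / (m + 1) -
          Real.log (n + 1 : ℕ) ^ (m + 1) / (m + 1)) := by
      simp only [stieltjesSeq]
      rw [Finset.sum_range_succ _ (n + 1)]
      push_cast
      ring
    rw [hstep, ih]
    linarith

theorem tendsto_stieltjesSeq {m : ℕ} (hm : m ≠ 0) :
    Tendsto (stieltjesSeq m) atTop (nhds (-2 * abelPlanaIntegral (logPowDiv m) 1)) := by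
  rw [← tendsto_add_atTop_iff_nat 1]
  simp only [stieltjesSeq_succ_eq hm]
  have hnat : Tendsto (fun n : ℕ => ((n + 1 : ℕ) : ℝ)) atTop atTop :=
    tendsto_natCast_atTop_atTop.comp (tendsto_add_atTop_nat 1)
  have h1 : Tendsto (fun n : ℕ => Real.log (n + 1 : ℕ) ^ m / (n + 1 : ℕ)) atTop (nhds 0) :=
    (Real.isLittleO_pow_log_id_atTop (n := m)).tendsto_div_nhds_zero.comp hnat
  have h2 : Tendsto (fun n : ℕ => abelPlanaIntegral (logPowDiv m) (n + 1 : ℕ)) atTop (nhds 0) := by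
    set J := ∫ y in Set.Ioi (0 : ℝ), y ^ 1 / (rexp (2 * π * y) - 1) with hJ
    have h3 : Tendsto (fun n : ℕ => 2 * (m.factorial * rexp π) / ((n + 1 : ℕ) : ℝ) * J) atTop
        (nhds 0) := by
      simpa using (hnat.const_div_atTop (2 * (m.factorial * rexp π))).mul_const J
    refine squeeze_zero_norm (fun n => ?_) h3
    have hge : (1 : ℝ) ≤ (n + 1 : ℕ) := by simp
    exact abs_abelPlanaIntegral_le
      (fun z hz => (hasDerivAt_logPowDiv m (by linarith)).differentiableAt)
      (by rw [logPowDiv_ofReal m (by linarith), Complex.ofReal_im])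
      (fun z hz => norm_deriv_logPowDiv_le hm hge hz)
  convert ((h1.div_const 2).sub_const (2 * abelPlanaIntegral (logPowDiv m) (1 : ℕ))).add
    (h2.const_mul 2) using 2
  simp

theorem setIntegral_lt_setIntegral_Ioi {u v : ℝ → ℝ} {a : ℝ}
    (hu : MeasureTheory.IntegrableOn u (Set.Ioi a)) (hv : MeasureTheory.IntegrableOn v (Set.Ioi a))
    (h : ∀ x ∈ Set.Ioi a, u x < v x) : ∫ x in Set.Ioi a, u x < ∫ x in Set.Ioi a, v x := by
  rw [← sub_pos, ← MeasureTheory.integral_sub hv hu,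
    MeasureTheory.setIntegral_pos_iff_support_of_nonneg_ae]
  · have : Function.support (fun x => v x - u x) ∩ Set.Ioi a = Set.Ioi a :=
      Set.inter_eq_right.2 fun x hx => (sub_pos.2 (h x hx)).ne'
    rw [this]
    simp
  · exact (MeasureTheory.ae_restrict_iff' measurableSet_Ioi).2
      (.of_forall fun x hx => (sub_pos.2 (h x hx)).le)
  · exact hv.sub hu

theorem integral_logPow_bounds {m : ℕ} (hm : m % 2 = 1)
    (hint : MeasureTheory.IntegrableOn (fun y : ℝ =>
      y ^ m * (normalizedLogPow m y).re / (rexp (2 * π * y) - 1)) (Set.Ioi 0)) :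
    |((bernoulli (m + 1) : ℚ) : ℝ)| / (2 * (m + 1)) -
        (3 * m + 8) * |((bernoulli (m + 3) : ℚ) : ℝ)| / 48 <
      ∫ y in Set.Ioi (0 : ℝ), y ^ m * (normalizedLogPow m y).re / (rexp (2 * π * y) - 1) ∧
    ∫ y in Set.Ioi (0 : ℝ), y ^ m * (normalizedLogPow m y).re / (rexp (2 * π * y) - 1) <
      |((bernoulli (m + 1) : ℚ) : ℝ)| / (2 * (m + 1)) := by
  have hI1 := integrableOn_pow_div_exp_sub_one (s := m) (by lia)
  have hI2 := (integrableOn_pow_div_exp_sub_one (s := m + 2) (by lia)).const_mul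
    (((m : ℝ) + 3) * (3 * m + 8) / 24)
  rw [← integral_pow_div_exp_sub_one hm]
  refine ⟨?_, setIntegral_lt_setIntegral_Ioi hint hI1 fun y hy => ?_⟩
  · have h2 : (3 * m + 8) * |((bernoulli (m + 3) : ℚ) : ℝ)| / 48 =
        ∫ y in Set.Ioi (0 : ℝ), ((m : ℝ) + 3) * (3 * m + 8) / 24 *
          (y ^ (m + 2) / (rexp (2 * π * y) - 1)) := by
      rw [MeasureTheory.integral_const_mul, integral_pow_div_exp_sub_one (s := m + 2) (by lia)]
      push_cast
      field_simp
      ring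
    rw [h2, ← MeasureTheory.integral_sub hI1 hI2]
    refine setIntegral_lt_setIntegral_Ioi (hI1.sub hI2) hint fun y hy => ?_
    have hy : 0 < y := hy
    have h0 := exp_two_pi_mul_sub_one_pos hy
    have h3 := mul_lt_mul_of_pos_left (lt_normalizedLogPow_re m hy) (pow_pos hy m)
    rw [← mul_div_assoc, ← sub_div]
    gcongr
    refine lt_of_eq_of_lt ?_ h3
    ring
  · have hy : 0 < y := hy
    have h0 := exp_two_pi_mul_sub_one_pos hy
    gcongr
    exact mul_lt_of_lt_one_right (pow_pos hy m) (normalizedLogPow_re_lt_one m hy)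

theorem integrableOn_im_logPowDiv {m : ℕ} (hm : m ≠ 0) :
    MeasureTheory.IntegrableOn (fun y : ℝ =>
      (logPowDiv m ((1 : ℝ) + y * Complex.I)).im / (rexp (2 * π * y) - 1)) (Set.Ioi 0) :=
  integrableOn_im_div_exp_sub_one
    (fun z hz => (hasDerivAt_logPowDiv m (by linarith)).differentiableAt)
    (by rw [logPowDiv_ofReal m one_pos, Complex.ofReal_im])
    (fun z hz => norm_deriv_logPowDiv_le hm le_rfl hz)

/-- Bernoulli-number bounds for `γ_m` when `m ≡ 1 (mod 4)` and `m ≡ 3 (mod 4)`. -/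
theorem stieltjes_bernoulli_bounds_odd (m : ℕ) (γm : ℝ)
    (hγ : Tendsto (stieltjesSeq m) atTop (nhds γm)) :
    (m % 4 = 1 →
      -(|((bernoulli (m + 1) : ℚ) : ℝ)| / (m + 1)) < γm ∧
      γm < (3 * m + 8) * |((bernoulli (m + 3) : ℚ) : ℝ)| / 24 -
            |((bernoulli (m + 1) : ℚ) : ℝ)| / (m + 1)) ∧
    (m % 4 = 3 →
      |((bernoulli (m + 1) : ℚ) : ℝ)| / (m + 1) -
          (3 * m + 8) * |((bernoulli (m + 3) : ℚ) : ℝ)| / 24 < γm ∧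
      γm < |((bernoulli (m + 1) : ℚ) : ℝ)| / (m + 1)) := by
  refine ⟨fun hm => ?_, fun hm => ?_⟩
  · have hm0 : m ≠ 0 := by lia
    have hγ' := tendsto_nhds_unique hγ (tendsto_stieltjesSeq hm0)
    have heq : Set.EqOn
        (fun y : ℝ => (logPowDiv m ((1 : ℝ) + y * Complex.I)).im / (rexp (2 * π * y) - 1))
        (fun y => y ^ m * (normalizedLogPow m y).re / (rexp (2 * π * y) - 1)) (Set.Ioi 0) := by
      intro y hy
      simp only [logPowDiv, Complex.ofReal_one]
      rw [im_log_pow_div m hy hm]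
    obtain ⟨h1, h2⟩ := integral_logPow_bounds (by lia)
      ((integrableOn_im_logPowDiv hm0).congr_fun heq measurableSet_Ioi)
    rw [← MeasureTheory.setIntegral_congr_fun measurableSet_Ioi heq, ← abelPlanaIntegral] at h1 h2
    rw [mul_comm (2 : ℝ), ← div_div] at h1 h2
    constructor <;> linarith
  · have hm0 : m ≠ 0 := by lia
    have hγ' := tendsto_nhds_unique hγ (tendsto_stieltjesSeq hm0)
    have heq : Set.EqOn
        (fun y : ℝ => -((logPowDiv m ((1 : ℝ) + y * Complex.I)).im / (rexp (2 * π * y) - 1)))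
        (fun y => y ^ m * (normalizedLogPow m y).re / (rexp (2 * π * y) - 1)) (Set.Ioi 0) := by
      intro y hy
      simp only [logPowDiv, Complex.ofReal_one]
      rw [im_log_pow_div' m hy hm, neg_div, neg_neg]
    obtain ⟨h1, h2⟩ := integral_logPow_bounds (by lia)
      ((integrableOn_im_logPowDiv hm0).neg.congr_fun heq measurableSet_Ioi)
    rw [← MeasureTheory.setIntegral_congr_fun measurableSet_Ioi heq, MeasureTheory.integral_neg,
      ← abelPlanaIntegral] at h1 h2
    rw [mul_comm (2 : ℝ), ← div_div] at h1 h2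
    constructor <;> linarith
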